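/- Evaluation formula: let gamma in PCl' have condensed encoding (mu, psi). Then for every v = (x, z) in V' (with x, z in (ZMod d')^n), gamma(Delta_v) = tau^((z.x).val) * zeta^((mu vbar).val) * Prod_{i=1}^{n} [ (Delta_(ulift(psi(e_i, 0))))^((x_i).val) * (Delta_(ulift(psi(0, e_i))))^((z_i).val) ], where (e_i, 0) and (0, e_i) denote the standard basis vectors of V with X-part resp. Z-part equal to the i-th indicator vector, and the product over i is taken in increasing order of i with the X-factor preceding the Z-factor. In particular, gamma(Delta_v) equals zeta^((mu vbar).val) * Delta_(ulift(psi vbar)) up to a sign in {1, -1}. -/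

import Mathlib

noncomputable section

namespace PaperPCl

/-- `d' = 2d` if `d` is even, `d' = d` if `d` is odd. -/
def dp (d : ℕ) : ℕ := if Even d then 2 * d else d

lemma d_dvd_dp (d : ℕ) : d ∣ dp d := by
  unfold dp; split
  · exact dvd_mul_left d 2
  · rfl

/-- The phase space `V = (ZMod d)^n × (ZMod d)^n`, vectors written `(q, p)`. -/
abbrev V (d n : ℕ) := (Fin n → ZMod d) × (Fin n → ZMod d)

/-- Dot product of two vectors in `(ZMod d)^n`. -/
def dotp {d n : ℕ} (p q : Fin n → ZMod d) : ZMod d := ∑ i, p i * q i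

/-- The standard symplectic form `omega((q1,p1),(q2,p2)) = p1·q2 - p2·q1`. -/
def omegaF {d n : ℕ} (v w : V d n) : ZMod d := dotp v.2 w.1 - dotp w.2 v.1

/-- Componentwise reduction mod `d`, `V' → V`. -/
def reduceV (d n : ℕ) (v : V (dp d) n) : V d n :=
  (fun i => ZMod.castHom (d_dvd_dp d) (ZMod d) (v.1 i),
   fun i => ZMod.castHom (d_dvd_dp d) (ZMod d) (v.2 i))

/-- Componentwise `val`-lift `V → V'`. -/
def liftV (d n : ℕ) (u : V d n) : V (dp d) n :=
  (fun i => ((u.1 i).val : ZMod (dp d)), fun i => ((u.2 i).val : ZMod (dp d)))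

/-- `zeta = exp(2 pi i / d)`. -/
def zeta (d : ℕ) : ℂ := Complex.exp (2 * Real.pi * Complex.I / d)

/-- `tau = exp(pi i / d)` if `d` is even, `tau = zeta^((d+1)/2)` if `d` is odd. -/
def tau (d : ℕ) : ℂ :=
  if Even d then Complex.exp (Real.pi * Complex.I / d) else zeta d ^ ((d + 1) / 2)

/-- The Pauli matrix `D_(q,p) = X^q Z^p`, a `d^n × d^n` complex matrix. -/
def Dop (d n : ℕ) [NeZero d] (u : V d n) : Matrix (Fin n → ZMod d) (Fin n → ZMod d) ℂ :=
  fun r s => if r = s + u.1 then zeta d ^ (dotp u.2 s).val else 0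

/-- The displacement operator `Delta_v = tau^(q·p) D_(vbar)` for `v = (q,p) ∈ V'`. -/
def Delta (d n : ℕ) [NeZero d] (v : V (dp d) n) : Matrix (Fin n → ZMod d) (Fin n → ZMod d) ℂ :=
  tau d ^ (dotp v.1 v.2).val • Dop d n (reduceV d n v)

/-- The large Pauli group `P'`: the subgroup of invertible `d^n × d^n` complex matrices
generated by the scalar matrix `tau • 1` together with all `D_u`, `u ∈ V`. -/
def Pgrp (d n : ℕ) [NeZero d] : Subgroup (Matrix (Fin n → ZMod d) (Fin n → ZMod d) ℂ)ˣ :=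
  Subgroup.closure {x | (x : Matrix (Fin n → ZMod d) (Fin n → ZMod d) ℂ)
      = tau d • (1 : Matrix (Fin n → ZMod d) (Fin n → ZMod d) ℂ)
    ∨ ∃ u : V d n, (x : Matrix (Fin n → ZMod d) (Fin n → ZMod d) ℂ) = Dop d n u}

/-- The underlying matrix of an element of `P'`. -/
def matVal {d n : ℕ} [NeZero d] (g : ↥(Pgrp d n)) : Matrix (Fin n → ZMod d) (Fin n → ZMod d) ℂ :=
  ((g : (Matrix (Fin n → ZMod d) (Fin n → ZMod d) ℂ)ˣ) : Matrix (Fin n → ZMod d) (Fin n → ZMod d) ℂ)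

/-- A function `γ : P' → P'` is center-respecting if `γ(z*g) = z*γ(g)`
for every `z` in the center of `P'`. -/
def CenterResp {d n : ℕ} [NeZero d] (γ : ↥(Pgrp d n) → ↥(Pgrp d n)) : Prop :=
  ∀ z ∈ Subgroup.center ↥(Pgrp d n), ∀ g, γ (z * g) = z * γ g

/-- A group automorphism of `P'` is projective Clifford if it fixes the center pointwise. -/
def IsPCl {d n : ℕ} [NeZero d] (γ : ↥(Pgrp d n) ≃* ↥(Pgrp d n)) : Prop :=
  ∀ z ∈ Subgroup.center ↥(Pgrp d n), γ z = z

/-- A linear automorphism is symplectic if it preserves the standard symplectic form. -/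
def IsSymp (d n : ℕ) (ψ : V d n ≃ₗ[ZMod d] V d n) : Prop :=
  ∀ u v : V d n, omegaF (ψ u) (ψ v) = omegaF u v

/-- `b` is a standard basis vector of `V`. -/
def IsStdBasis {d n : ℕ} (b : V d n) : Prop :=
  (∃ i : Fin n, b = (Pi.single i 1, 0)) ∨ (∃ i : Fin n, b = (0, Pi.single i 1))

lemma zeta_pow_val (d : ℕ) [NeZero d] (a : ZMod d) : zeta d ^ a.val = ZMod.stdAddChar a := by
  rw [ZMod.stdAddChar_apply, ZMod.toCircle_apply, zeta, ← Complex.exp_nat_mul]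
  congr 1
  ring

lemma tau_sq (d : ℕ) [NeZero d] : tau d ^ 2 = zeta d := by
  have hd : (d : ℂ) ≠ 0 := Nat.cast_ne_zero.mpr (NeZero.ne d)
  unfold tau
  split_ifs with h
  · rw [← Complex.exp_nat_mul, zeta]
    congr 1
    push_cast
    ring
  · have hodd : Odd d := Nat.not_even_iff_odd.mp h
    have hone : zeta d ^ d = 1 := by
      rw [zeta, ← Complex.exp_nat_mul, mul_div_cancel₀ _ hd, Complex.exp_two_pi_mul_I]
    rw [← pow_mul, Nat.div_mul_cancel hodd.add_one.two_dvd, pow_succ, hone, one_mul]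

lemma tau_ne_zero (d : ℕ) [NeZero d] : tau d ≠ 0 := by
  intro h
  have h2 := tau_sq d
  rw [h, zero_pow two_ne_zero] at h2
  exact Complex.exp_ne_zero _ h2.symm

instance dp_neZero (d : ℕ) [NeZero d] : NeZero (dp d) :=
  ⟨by unfold dp; have := NeZero.ne d; split_ifs <;> omega⟩

lemma natCast_val_eq_castHom (d : ℕ) [NeZero d] (a : ZMod (dp d)) :
    ((a.val : ℕ) : ZMod d) = ZMod.castHom (d_dvd_dp d) (ZMod d) a := by
  rw [ZMod.castHom_apply, ZMod.natCast_val]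

lemma zeta_pow_val_dp (d : ℕ) [NeZero d] (a : ZMod (dp d)) :
    zeta d ^ a.val = ZMod.stdAddChar (ZMod.castHom (d_dvd_dp d) (ZMod d) a) := by
  have h1 : zeta d = ZMod.stdAddChar (1 : ZMod d) := by
    have := ZMod.stdAddChar_coe (N := d) 1
    rw [Int.cast_one] at this
    rw [this, zeta]
    congr 1
    push_cast
    ring
  rw [h1, ← AddChar.map_nsmul_eq_pow, nsmul_one, natCast_val_eq_castHom]

lemma tau_pow_val_sq (d : ℕ) [NeZero d] (a : ZMod (dp d)) :
    (tau d ^ a.val) ^ 2 = ZMod.stdAddChar (ZMod.castHom (d_dvd_dp d) (ZMod d) a) := by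
  rw [← pow_mul, mul_comm, pow_mul, tau_sq, zeta_pow_val_dp]

section Dotp

variable {d n : ℕ} (a b c : Fin n → ZMod d)

lemma dotp_comm : dotp a b = dotp b a := dotProduct_comm a b

lemma dotp_add : dotp a (b + c) = dotp a b + dotp a c := dotProduct_add a b c

lemma add_dotp : dotp (a + b) c = dotp a c + dotp b c := add_dotProduct a b c

@[simp] lemma dotp_zero : dotp a 0 = 0 := dotProduct_zero a

@[simp] lemma zero_dotp : dotp 0 a = 0 := zero_dotProduct a

lemma dotp_single (i : Fin n) (x : ZMod d) : dotp a (Pi.single i x) = a i * x :=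
  dotProduct_single _ x i

lemma single_dotp (i : Fin n) (x : ZMod d) : dotp (Pi.single i x) a = x * a i :=
  single_dotProduct _ x i

lemma castHom_dotp [NeZero d] (p q : Fin n → ZMod (dp d)) :
    ZMod.castHom (d_dvd_dp d) (ZMod d) (dotp p q)
      = dotp (fun i => ZMod.castHom (d_dvd_dp d) (ZMod d) (p i))
          (fun i => ZMod.castHom (d_dvd_dp d) (ZMod d) (q i)) := by
  simp only [dotp, map_sum, map_mul]

end Dotp

lemma reduceV_liftV (d n : ℕ) [NeZero d] (u : V d n) : reduceV d n (liftV d n u) = u := by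
  simp [reduceV, liftV]

section Coordinates

variable {d n : ℕ}

/-- The coordinate component `(x_i e_i, z_i e_i)` of a phase space vector `(x, z)`. -/
def coordV (u : V d n) (i : Fin n) : V d n := (Pi.single i (u.1 i), Pi.single i (u.2 i))

lemma sum_map_coordV (u : V d n) : ((List.finRange n).map (coordV u)).sum = u := by
  have : ((List.finRange n).map (coordV u)).sum = ∑ i, coordV u i := by
    rw [← List.ofFn_eq_map, List.sum_ofFn]
  rw [this]
  ext j <;> simp [coordV, Prod.fst_sum, Prod.snd_sum, Finset.sum_apply, Pi.single_apply]

lemma sum_map_coordV_apply (u : V d n) (i : Fin n) (l : List (Fin n)) (hi : i ∉ l) :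
    (l.map (coordV u)).sum.1 i = 0 ∧ (l.map (coordV u)).sum.2 i = 0 := by
  induction l with
  | nil => simp
  | cons j l ih =>
    rw [List.mem_cons, not_or] at hi
    simp [coordV, ih hi.2, Pi.single_eq_of_ne hi.1]

lemma coordV_eq (u : V d n) (i : Fin n) :
    coordV u i = u.1 i • ((Pi.single i 1, 0) : V d n) + u.2 i • ((0, Pi.single i 1) : V d n) := by
  simp [coordV, ← Pi.single_smul]

end Coordinates

section Pauli

variable {d n : ℕ} [NeZero d]

lemma Dop_zero : Dop d n 0 = 1 := by
  ext r s
  simp [Dop, Matrix.one_apply]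

lemma Dop_mul (u w : V d n) :
    Dop d n u * Dop d n w = (ZMod.stdAddChar (dotp u.2 w.1) : ℂ) • Dop d n (u + w) := by
  ext r s
  rw [Matrix.mul_apply, Finset.sum_eq_single (s + w.1)]
  · simp only [Dop, zeta_pow_val, Matrix.smul_apply, smul_eq_mul, Prod.fst_add, Prod.snd_add,
      dotp_add, add_dotp, AddChar.map_add_eq_mul, add_assoc, add_comm w.1 u.1, if_true]
    split_ifs
    · ring
    · simp
  · intro t _ ht
    simp [Dop, ht]
  · simp

lemma Dop_single_fst_pow (i : Fin n) (k : ℕ) :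
    Dop d n (Pi.single i 1, 0) ^ k = Dop d n (Pi.single i (k : ZMod d), 0) := by
  induction k with
  | zero => simp [← Dop_zero]; rfl
  | succ k ih => rw [pow_succ, ih, Dop_mul]; simp [Pi.single_add]

lemma Dop_single_snd_pow (i : Fin n) (k : ℕ) :
    Dop d n (0, Pi.single i 1) ^ k = Dop d n (0, Pi.single i (k : ZMod d)) := by
  induction k with
  | zero => simp [← Dop_zero]; rfl
  | succ k ih => rw [pow_succ, ih, Dop_mul]; simp [Pi.single_add]

lemma prod_map_Dop_coordV (u : V d n) (l : List (Fin n)) (hl : l.Nodup) :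
    (l.map (fun i => Dop d n (coordV u i))).prod = Dop d n (l.map (coordV u)).sum := by
  induction l with
  | nil => simp [Dop_zero]
  | cons j l ih =>
    rw [List.nodup_cons] at hl
    rw [List.map_cons, List.prod_cons, ih hl.2, Dop_mul, List.map_cons, List.sum_cons]
    simp [coordV, single_dotp, (sum_map_coordV_apply u j l hl.1).1]

/-- `A` is the Weyl operator of `u` up to a square root of the phase attached to `m`,
where the Weyl operator itself is `D_u` scaled by a square root of the phase of `q·p`. -/
def IsWeyl (A : Matrix (Fin n → ZMod d) (Fin n → ZMod d) ℂ) (m : ZMod d) (u : V d n) : Prop :=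
  ∃ c : ℂ, c ^ 2 = ZMod.stdAddChar (m + dotp u.1 u.2) ∧ A = c • Dop d n u

lemma isWeyl_one : IsWeyl (1 : Matrix (Fin n → ZMod d) (Fin n → ZMod d) ℂ) 0 0 :=
  ⟨1, by simp, by simp [Dop_zero]⟩

lemma IsWeyl.mul {A B : Matrix (Fin n → ZMod d) (Fin n → ZMod d) ℂ} {m k : ZMod d} {u w : V d n}
    (hA : IsWeyl A m u) (hB : IsWeyl B k w) : IsWeyl (A * B) (m + k + omegaF u w) (u + w) := by
  obtain ⟨a, ha, rfl⟩ := hA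
  obtain ⟨b, hb, rfl⟩ := hB
  refine ⟨a * b * ZMod.stdAddChar (dotp u.2 w.1), ?_, ?_⟩
  · rw [mul_pow, mul_pow, ha, hb, sq, ← AddChar.map_add_eq_mul, ← AddChar.map_add_eq_mul,
      ← AddChar.map_add_eq_mul]
    congr 1
    simp only [omegaF, Prod.fst_add, Prod.snd_add, dotp_add, add_dotp]
    rw [dotp_comm w.1 u.2, dotp_comm w.2 u.1]
    ring
  · rw [smul_mul_smul_comm, Dop_mul, smul_smul]

lemma IsWeyl.pow {A : Matrix (Fin n → ZMod d) (Fin n → ZMod d) ℂ} {u : V d n}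
    (hA : IsWeyl A 0 u) (k : ℕ) : IsWeyl (A ^ k) 0 ((k : ZMod d) • u) := by
  induction k with
  | zero => simpa using isWeyl_one
  | succ k ih =>
    have h0 : omegaF ((k : ZMod d) • u) u = 0 := by
      change (_ • u.2) ⬝ᵥ u.1 - u.2 ⬝ᵥ (_ • u.1) = 0
      simp
    have h := ih.mul hA
    rw [h0, add_zero, add_zero] at h
    rwa [pow_succ, Nat.cast_succ, add_smul, one_smul]

lemma IsWeyl.smul {A : Matrix (Fin n → ZMod d) (Fin n → ZMod d) ℂ} {m k : ZMod d} {u : V d n}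
    (hA : IsWeyl A m u) {c : ℂ} (hc : c ^ 2 = ZMod.stdAddChar k) : IsWeyl (c • A) (k + m) u := by
  obtain ⟨a, ha, rfl⟩ := hA
  exact ⟨c * a, by rw [mul_pow, hc, ha, ← AddChar.map_add_eq_mul, add_assoc], smul_smul _ _ _⟩

lemma isWeyl_Delta (v : V (dp d) n) : IsWeyl (Delta d n v) 0 (reduceV d n v) :=
  ⟨_, by rw [tau_pow_val_sq, castHom_dotp, zero_add]; rfl, rfl⟩

lemma isWeyl_Delta_liftV (u : V d n) : IsWeyl (Delta d n (liftV d n u)) 0 u := by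
  simpa only [reduceV_liftV] using isWeyl_Delta (liftV d n u)

lemma IsWeyl.eq_or_eq_neg {A B : Matrix (Fin n → ZMod d) (Fin n → ZMod d) ℂ} {m : ZMod d}
    {u : V d n} (hA : IsWeyl A m u) (hB : IsWeyl B m u) : A = B ∨ A = -B := by
  obtain ⟨a, ha, rfl⟩ := hA
  obtain ⟨b, hb, rfl⟩ := hB
  rcases sq_eq_sq_iff_eq_or_eq_neg.mp (ha.trans hb.symm) with rfl | rfl
  · exact Or.inl rfl
  · exact Or.inr (neg_smul _ _)

lemma isWeyl_prod (v : V (dp d) n) (ψ : V d n ≃ₗ[ZMod d] V d n) (hψ : IsSymp d n ψ)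
    (l : List (Fin n)) (hl : l.Nodup) :
    IsWeyl (l.map (fun i =>
        Delta d n (liftV d n (ψ (Pi.single i 1, 0))) ^ (v.1 i).val *
        Delta d n (liftV d n (ψ (0, Pi.single i 1))) ^ (v.2 i).val)).prod
      (-(l.map (fun i => (reduceV d n v).1 i * (reduceV d n v).2 i)).sum)
      (ψ (l.map (coordV (reduceV d n v))).sum) := by
  induction l with
  | nil => simpa using isWeyl_one
  | cons j l ih =>
    rw [List.nodup_cons] at hl
    have hX := (isWeyl_Delta_liftV (ψ (Pi.single j 1, 0))).pow (v.1 j).val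
    have hZ := (isWeyl_Delta_liftV (ψ (0, Pi.single j 1))).pow (v.2 j).val
    rw [natCast_val_eq_castHom, ← map_smul] at hX hZ
    have h := (hX.mul hZ).mul (ih hl.2)
    rw [← map_add, hψ, hψ, ← map_add] at h
    have hc := sum_map_coordV_apply (reduceV d n v) j l hl.1
    have hu : (ZMod.castHom (d_dvd_dp d) (ZMod d) (v.1 j)) • ((Pi.single j 1, 0) : V d n)
        + (ZMod.castHom (d_dvd_dp d) (ZMod d) (v.2 j)) • ((0, Pi.single j 1) : V d n)
        = coordV (reduceV d n v) j :=
      (coordV_eq (reduceV d n v) j).symm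
    rw [hu] at h
    have h0 : omegaF (coordV (reduceV d n v) j) (l.map (coordV (reduceV d n v))).sum = 0 := by
      simp [omegaF, coordV, single_dotp, dotp_single, hc]
    rw [h0] at h
    simp only [List.map_cons, List.prod_cons, List.sum_cons]
    convert h using 1
    simp [omegaF, dotp_single, ← Pi.single_smul, reduceV]
    ring

/-- `D_u` as an invertible matrix. -/
def DopUnit (u : V d n) : (Matrix (Fin n → ZMod d) (Fin n → ZMod d) ℂ)ˣ where
  val := Dop d n u
  inv := (ZMod.stdAddChar (dotp u.2 u.1) : ℂ) • Dop d n (-u)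
  val_inv := by
    rw [mul_smul_comm, Dop_mul, smul_smul, ← AddChar.map_add_eq_mul, add_neg_cancel, Dop_zero]
    change (ZMod.stdAddChar (u.2 ⬝ᵥ u.1 + u.2 ⬝ᵥ (-u.1)) : ℂ) • _ = _
    simp
  inv_val := by
    rw [smul_mul_assoc, Dop_mul, smul_smul, ← AddChar.map_add_eq_mul, neg_add_cancel, Dop_zero]
    change (ZMod.stdAddChar (u.2 ⬝ᵥ u.1 + (-u.2) ⬝ᵥ u.1) : ℂ) • _ = _
    simp

/-- `D_u` as an element of the large Pauli group. -/
def DopP (u : V d n) : Pgrp d n :=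
  ⟨DopUnit u, Subgroup.subset_closure (Or.inr ⟨u, rfl⟩)⟩

variable (d n) in
/-- The scalar matrix `tau • 1` as an element of the large Pauli group. -/
def tauP : Pgrp d n :=
  ⟨⟨tau d • 1, (tau d)⁻¹ • 1, by simp [smul_smul, tau_ne_zero], by simp [smul_smul, tau_ne_zero]⟩,
    Subgroup.subset_closure (Or.inl rfl)⟩

/-- `matVal` as a monoid homomorphism. -/
def matValHom : Pgrp d n →* Matrix (Fin n → ZMod d) (Fin n → ZMod d) ℂ :=
  (Units.coeHom _).comp (Pgrp d n).subtype

lemma matVal_eq (g : Pgrp d n) : matVal g = matValHom g := rfl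

lemma matValHom_injective : Function.Injective (matValHom (d := d) (n := n)) :=
  fun _ _ h => Subtype.ext (Units.ext h)

lemma matValHom_DopP (u : V d n) : matValHom (DopP u) = Dop d n u := rfl

lemma matValHom_tauP_pow (k : ℕ) : matValHom (tauP d n ^ k) = tau d ^ k • 1 := by
  rw [map_pow]
  change (tau d • (1 : Matrix (Fin n → ZMod d) (Fin n → ZMod d) ℂ)) ^ k = _
  rw [smul_pow, one_pow]

lemma tauP_pow_mem_center (k : ℕ) : tauP d n ^ k ∈ Subgroup.center (Pgrp d n) := by
  refine Subgroup.mem_center_iff.mpr fun g => matValHom_injective ?_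
  rw [map_mul, map_mul, matValHom_tauP_pow]
  simp

lemma Delta_liftV_single_fst (i : Fin n) :
    Delta d n (liftV d n (Pi.single i 1, 0)) = Dop d n (Pi.single i 1, 0) := by
  rw [Delta, reduceV_liftV]
  simp [liftV, dotp]

lemma Delta_liftV_single_snd (i : Fin n) :
    Delta d n (liftV d n (0, Pi.single i 1)) = Dop d n (0, Pi.single i 1) := by
  rw [Delta, reduceV_liftV]
  simp [liftV, dotp]

lemma Delta_eq_matValHom (v : V (dp d) n) :
    Delta d n v = matValHom (tauP d n ^ (dotp v.2 v.1).val *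
      ((List.finRange n).map (fun i => DopP (Pi.single i 1, 0) ^ (v.1 i).val *
        DopP (0, Pi.single i 1) ^ (v.2 i).val)).prod) := by
  have h : ∀ i, Dop d n (Pi.single i 1, 0) ^ (v.1 i).val * Dop d n (0, Pi.single i 1) ^ (v.2 i).val
      = Dop d n (coordV (reduceV d n v) i) := by
    intro i
    rw [Dop_single_fst_pow, Dop_single_snd_pow, Dop_mul, natCast_val_eq_castHom,
      natCast_val_eq_castHom]
    simp [coordV, reduceV]
  rw [map_mul, matValHom_tauP_pow, map_list_prod, List.map_map]
  simp only [Function.comp_def, map_mul, map_pow, matValHom_DopP, h]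
  rw [prod_map_Dop_coordV _ _ (List.nodup_finRange n), sum_map_coordV, smul_mul_assoc, one_mul,
    Delta, dotp_comm]

lemma prod_map_smul {ι : Type*} (l : List ι) (c : ι → ℂ)
    (A : ι → Matrix (Fin n → ZMod d) (Fin n → ZMod d) ℂ) :
    (l.map (fun i => c i • A i)).prod = (l.map c).prod • (l.map A).prod := by
  induction l with
  | nil => simp
  | cons j l ih => simp only [List.map_cons, List.prod_cons, ih, smul_mul_smul_comm]

lemma prod_map_stdAddChar (mu : V d n →ₗ[ZMod d] ZMod d) (v : V (dp d) n) :
    ((List.finRange n).map (fun i =>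
      (ZMod.stdAddChar (mu (Pi.single i 1, 0)) : ℂ) ^ (v.1 i).val *
        (ZMod.stdAddChar (mu (0, Pi.single i 1)) : ℂ) ^ (v.2 i).val)).prod
      = ZMod.stdAddChar (mu (reduceV d n v)) := by
  have h : ∀ i, (ZMod.stdAddChar (mu (Pi.single i 1, 0)) : ℂ) ^ (v.1 i).val *
      (ZMod.stdAddChar (mu (0, Pi.single i 1)) : ℂ) ^ (v.2 i).val
      = ZMod.stdAddChar (mu (coordV (reduceV d n v) i)) := by
    intro i
    rw [← AddChar.map_nsmul_eq_pow, ← AddChar.map_nsmul_eq_pow, ← AddChar.map_add_eq_mul,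
      coordV_eq, mu.map_add, mu.map_smul, mu.map_smul, nsmul_eq_mul, nsmul_eq_mul, natCast_val_eq_castHom,
      natCast_val_eq_castHom]
    rfl
  have hl : ∀ l : List (Fin n),
      (l.map (fun i => (ZMod.stdAddChar (mu (coordV (reduceV d n v) i)) : ℂ))).prod
        = ZMod.stdAddChar (mu (l.map (coordV (reduceV d n v))).sum) := by
    intro l
    induction l with
    | nil => simp
    | cons j l ih => simp [ih, AddChar.map_add_eq_mul]
  simp only [h]
  rw [hl, sum_map_coordV]

end Pauli


theorem evaluation_formula (d n : ℕ) [NeZero d] (hd : 2 ≤ d) (hn : 1 ≤ n)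
    (γ : ↥(Pgrp d n) ≃* ↥(Pgrp d n)) (hγ : IsPCl γ)
    (mu : V d n →ₗ[ZMod d] ZMod d) (ψ : V d n ≃ₗ[ZMod d] V d n) (hψ : IsSymp d n ψ)
    (henc : ∀ b : V d n, IsStdBasis b → ∀ g : ↥(Pgrp d n), matVal g = Delta d n (liftV d n b) →
        matVal (γ g) = zeta d ^ (mu b).val • Delta d n (liftV d n (ψ b))) :
    ∀ v : V (dp d) n, ∀ g : ↥(Pgrp d n), matVal g = Delta d n v →
      (matVal (γ g) =
        (tau d ^ (dotp v.2 v.1).val * zeta d ^ (mu (reduceV d n v)).val) •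
          ((List.finRange n).map (fun i =>
            Delta d n (liftV d n (ψ (Pi.single i 1, 0))) ^ (v.1 i).val *
            Delta d n (liftV d n (ψ (0, Pi.single i 1))) ^ (v.2 i).val)).prod)
      ∧ ∃ ε : ℂ, (ε = 1 ∨ ε = -1) ∧
          matVal (γ g) =
            (ε * zeta d ^ (mu (reduceV d n v)).val) • Delta d n (liftV d n (ψ (reduceV d n v))) := by
  intro v g hg
  have hX : ∀ i : Fin n, matValHom (γ (DopP (Pi.single i 1, 0)))
      = (ZMod.stdAddChar (mu (Pi.single i 1, 0)) : ℂ) •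
        Delta d n (liftV d n (ψ (Pi.single i 1, 0))) := fun i => by
    rw [← matVal_eq, henc _ (Or.inl ⟨i, rfl⟩) (DopP _) (Delta_liftV_single_fst i).symm, zeta_pow_val]
  have hZ : ∀ i : Fin n, matValHom (γ (DopP (0, Pi.single i 1)))
      = (ZMod.stdAddChar (mu (0, Pi.single i 1)) : ℂ) •
        Delta d n (liftV d n (ψ (0, Pi.single i 1))) := fun i => by
    rw [← matVal_eq, henc _ (Or.inr ⟨i, rfl⟩) (DopP _) (Delta_liftV_single_snd i).symm, zeta_pow_val]
  have hformula : matVal (γ g) =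
      (tau d ^ (dotp v.2 v.1).val * zeta d ^ (mu (reduceV d n v)).val) •
        ((List.finRange n).map (fun i =>
          Delta d n (liftV d n (ψ (Pi.single i 1, 0))) ^ (v.1 i).val *
          Delta d n (liftV d n (ψ (0, Pi.single i 1))) ^ (v.2 i).val)).prod := by
    rw [matValHom_injective (hg.trans (Delta_eq_matValHom v)), map_mul,
      hγ _ (tauP_pow_mem_center _), matVal_eq, map_mul, matValHom_tauP_pow, map_list_prod,
      map_list_prod, List.map_map, List.map_map]
    simp only [Function.comp_def, map_mul, map_pow, hX, hZ, smul_pow, smul_mul_smul_comm]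
    rw [prod_map_smul, prod_map_stdAddChar, smul_mul_assoc, one_mul, smul_smul, zeta_pow_val]
  refine ⟨hformula, ?_⟩
  have hW := (isWeyl_prod v ψ hψ _ (List.nodup_finRange n)).smul
    (tau_pow_val_sq d (dotp v.2 v.1))
  have hsum : ((List.finRange n).map
      (fun i => (reduceV d n v).1 i * (reduceV d n v).2 i)).sum
      = ZMod.castHom (d_dvd_dp d) (ZMod d) (dotp v.2 v.1) := by
    rw [castHom_dotp, dotp_comm, ← List.ofFn_eq_map, List.sum_ofFn]
    rfl
  rw [hsum, add_neg_cancel, sum_map_coordV] at hW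
  rw [hformula, mul_comm, ← smul_smul]
  rcases hW.eq_or_eq_neg (isWeyl_Delta_liftV _) with h | h
  · exact ⟨1, Or.inl rfl, by rw [h, one_mul]⟩
  · exact ⟨-1, Or.inr rfl, by rw [h, neg_one_mul, neg_smul, smul_neg]⟩

end PaperPCl
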